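/- arXiv:2604.08533 — 2 statements merged into one kernel-verified Lean document; each statement's English description precedes it below -/
import Mathlib

section
/- Let M be a ℤⁿ-graded F-finite F-module over R = K[X₁,…,Xₙ]. Then for every i ∈ {1,…,n}, every j ∈ {0,1}, and every u ∈ ℤⁿ with uᵢ ≠ 0, the degree-u component of the Koszul homology H_j(Xᵢ; M) vanishes; explicitly, M_u = Xᵢ·M_{u−eᵢ} and the multiplication map Xᵢ : M_{u−eᵢ} → M_u is injective, hence Xᵢ : M_{u−eᵢ} → M_u is bijective whenever uᵢ ≠ 0. -/
set_option maxHeartbeats 1000000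
set_option synthInstance.maxHeartbeats 1000000

open scoped TensorProduct

noncomputable section

/-- `R = A[X₁, …, Xₙ]`, the polynomial ring in `n` variables over `A`,
`ℕⁿ`-graded with `A` in degree `0` and `deg Xⱼ = eⱼ`. -/
abbrev PolyR (n : ℕ) (A : Type) [CommRing A] : Type := MvPolynomial (Fin n) A

/-- A polynomial is (multi)homogeneous of degree `d ∈ ℤⁿ` if every monomial occurring in it
has exponent vector `d` (under the grading `deg Xⱼ = eⱼ`). -/
def IsHomog {n : ℕ} {A : Type} [CommRing A] (r : PolyR n A) (d : Fin n → ℤ) : Prop :=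
  ∀ m ∈ r.support, (fun i => ((m i : ℕ) : ℤ)) = d

/-- Type synonym: `R` viewed as an `R`-algebra via the Frobenius `r ↦ r ^ p`. -/
@[nolint unusedArguments]
def FrobTwist (_p n : ℕ) (A : Type) [CommRing A] : Type := PolyR n A

instance (p n : ℕ) (A : Type) [CommRing A] : CommRing (FrobTwist p n A) :=
  inferInstanceAs (CommRing (PolyR n A))

/-- The Frobenius `r ↦ r ^ p`, as a ring homomorphism `R →+* FrobTwist p n A`. -/
def frobToTwist (p n : ℕ) (A : Type) [CommRing A] [Fact p.Prime] [CharP A p] :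
    PolyR n A →+* FrobTwist p n A := frobenius (PolyR n A) p

/-- The `R`-algebra structure on `FrobTwist p n A` given by the Frobenius. -/
instance (p n : ℕ) (A : Type) [CommRing A] [Fact p.Prime] [CharP A p] :
    Algebra (PolyR n A) (FrobTwist p n A) := (frobToTwist p n A).toAlgebra

/-- `F(M) = R ⊗_R M`, the base change of `M` along the Frobenius endomorphism of `R`,
an `R`-module via the left factor. -/
def FF (p n : ℕ) (A : Type) [CommRing A] [Fact p.Prime] [CharP A p]
    (M : Type) [AddCommGroup M] [Module (PolyR n A) M] : Type :=
  FrobTwist p n A ⊗[PolyR n A] M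

section FFInst

variable (p n : ℕ) (A : Type) [CommRing A] [Fact p.Prime] [CharP A p]
variable (M N : Type) [AddCommGroup M] [Module (PolyR n A) M]
  [AddCommGroup N] [Module (PolyR n A) N]

instance : AddCommGroup (FF p n A M) :=
  inferInstanceAs (AddCommGroup (FrobTwist p n A ⊗[PolyR n A] M))

instance : Module (PolyR n A) (FF p n A M) :=
  inferInstanceAs (Module (FrobTwist p n A) (FrobTwist p n A ⊗[PolyR n A] M))

instance : Module A (FF p n A M) :=
  Module.compHom (FF p n A M) (algebraMap A (PolyR n A))

instance : IsScalarTower A (PolyR n A) (FF p n A M) where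
  smul_assoc a r x := by
    show ((a • r) • x : FF p n A M) = (algebraMap A (PolyR n A) a) • (r • x)
    rw [Algebra.smul_def, mul_smul]

/-- Inclusion of elements of the tensor product into `F(M)`. -/
def FF.of (x : FrobTwist p n A ⊗[PolyR n A] M) : FF p n A M := x

/-- An element of `R`, viewed in `FrobTwist p n A`. -/
def twist (r : PolyR n A) : FrobTwist p n A := r

/-- The degree-`u` component of `F(M)` induced by a grading `gr` on `M`:
the `A`-span of the homogeneous tensors `r ⊗ m` with `deg(r ⊗ m) = deg r + p • deg m = u`. -/
def FF.comp [Module A M] (gr : (Fin n → ℤ) → Submodule A M) (u : Fin n → ℤ) :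
    Submodule A (FF p n A M) :=
  Submodule.span A { x : FF p n A M |
    ∃ (r : PolyR n A) (d v : Fin n → ℤ) (m : M),
      IsHomog r d ∧ m ∈ gr v ∧ d + p • v = u ∧
      x = FF.of p n A M (twist p n A r ⊗ₜ[PolyR n A] m) }

/-- Functoriality of `F`. -/
def FF.map {M N} [AddCommGroup M] [Module (PolyR n A) M]
    [AddCommGroup N] [Module (PolyR n A) N] (f : M →ₗ[PolyR n A] N) :
    FF p n A M →ₗ[PolyR n A] FF p n A N :=
  LinearMap.baseChange (FrobTwist p n A) f

end FFInst

/-- A bundled `ℤⁿ`-graded module over `R = A[X₁,…,Xₙ]`: a module together with a family of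
`A`-submodules indexed by `ℤⁿ` (the candidate graded components). -/
structure GrMod (p n : ℕ) (A : Type) [CommRing A] [Fact p.Prime] [CharP A p] : Type 1 where
  carrier : Type
  [acg : AddCommGroup carrier]
  [modA : Module A carrier]
  [modR : Module (PolyR n A) carrier]
  [tower : IsScalarTower A (PolyR n A) carrier]
  gr : (Fin n → ℤ) → Submodule A carrier

attribute [instance] GrMod.acg GrMod.modA GrMod.modR GrMod.tower

variable {p n : ℕ} {A : Type} [CommRing A] [Fact p.Prime] [CharP A p]

/-- The Frobenius functor applied to a bundled graded module, with the induced grading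
`deg(r ⊗ m) = deg r + p • deg m`. -/
def GrMod.F (X : GrMod p n A) : GrMod p n A where
  carrier := FF p n A X.carrier
  gr := FF.comp p n A X.carrier X.gr

/-- Iterates `F^k(X)` of the Frobenius functor on a bundled graded module. -/
def GrMod.FPow (X : GrMod p n A) : ℕ → GrMod p n A
  | 0 => X
  | (k + 1) => (X.FPow k).F

/-- The maps `F^k(β) : F^k(U) → F^(k+1)(U)` of the direct system induced by a generating
morphism `β : U → F(U)`. -/
def GrMod.seqMap (X : GrMod p n A) (β : X.carrier →ₗ[PolyR n A] X.F.carrier) :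
    ∀ k : ℕ, (X.FPow k).carrier →ₗ[PolyR n A] (X.FPow (k + 1)).carrier
  | 0 => β
  | (k + 1) => FF.map p n A (X.seqMap β k)

/-- The composite transition maps `F^k(U) → F^(k+l)(U)` of the direct system. -/
def GrMod.trans (X : GrMod p n A) (β : X.carrier →ₗ[PolyR n A] X.F.carrier) :
    ∀ (k l : ℕ), (X.FPow k).carrier →ₗ[PolyR n A] (X.FPow (k + l)).carrier
  | _, 0 => LinearMap.id
  | k, (l + 1) => (X.seqMap β (k + l)).comp (X.trans β k l)

/-- `M`, together with the family `gr` of its `A`-submodule components, is a `ℤⁿ`-graded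
`F`-finite `F`-module over `R = A[X₁,…,Xₙ]`.  The fields say:
* `gr` is a `ℤⁿ`-grading of `M` by `A`-submodules making `M` a graded `R`-module
  (`isInternal`, `smul_X_mem`);
* `theta : M ≅ F(M)` is a degree-preserving `R`-linear isomorphism (`theta`, `theta_grade`),
  where the grading on `F(M)` is given by `deg (r ⊗ m) = deg r + p • deg m`;
* `M` is the direct limit of `U →β F(U) →F(β) F²(U) → ⋯` for a degree-preserving generating
  morphism `β : U → F(U)` from a finitely generated `ℤⁿ`-graded module `U` (= `gen.carrier`),
  via degree-preserving structure maps `toLim k : F^k(U) → M` (`toLim_compat`, `toLim_grade`,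
  `toLim_surj`, `toLim_ker` say precisely that `M` is the colimit of the system), compatibly
  with `theta` (`theta_compat`). -/
structure ZGradedFFiniteFModule (p n : ℕ) (A : Type) [CommRing A] [Fact p.Prime] [CharP A p]
    (M : Type) [AddCommGroup M] [Module A M] [Module (PolyR n A) M]
    [IsScalarTower A (PolyR n A) M]
    (gr : (Fin n → ℤ) → Submodule A M) : Type 1 where
  isInternal : DirectSum.IsInternal gr
  smul_X_mem : ∀ (i : Fin n) (u : Fin n → ℤ), ∀ m ∈ gr u,
    (MvPolynomial.X i : PolyR n A) • m ∈ gr (u + Pi.single i 1)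
  theta : M ≃ₗ[PolyR n A] FF p n A M
  theta_grade : ∀ (u : Fin n → ℤ), ∀ m ∈ gr u, theta m ∈ FF.comp p n A M gr u
  gen : GrMod p n A
  gen_fg : Module.Finite (PolyR n A) gen.carrier
  gen_internal : DirectSum.IsInternal gen.gr
  gen_smul_X_mem : ∀ (i : Fin n) (u : Fin n → ℤ), ∀ x ∈ gen.gr u,
    (MvPolynomial.X i : PolyR n A) • x ∈ gen.gr (u + Pi.single i 1)
  beta : gen.carrier →ₗ[PolyR n A] gen.F.carrier
  beta_grade : ∀ (u : Fin n → ℤ), ∀ x ∈ gen.gr u, beta x ∈ gen.F.gr u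
  toLim : ∀ k : ℕ, (gen.FPow k).carrier →ₗ[PolyR n A] M
  toLim_compat : ∀ (k : ℕ) (x : (gen.FPow k).carrier),
    toLim (k + 1) (gen.seqMap beta k x) = toLim k x
  toLim_grade : ∀ (k : ℕ) (u : Fin n → ℤ), ∀ x ∈ (gen.FPow k).gr u, toLim k x ∈ gr u
  toLim_surj : ∀ m : M, ∃ (k : ℕ) (x : (gen.FPow k).carrier), toLim k x = m
  toLim_ker : ∀ (k : ℕ) (x : (gen.FPow k).carrier), toLim k x = 0 →
    ∃ l : ℕ, gen.trans beta k l x = 0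
  theta_compat : ∀ (k : ℕ) (x : (gen.FPow k).carrier),
    theta (toLim k x) = FF.map p n A (toLim k) (gen.seqMap beta k x)

/-- The block `B(U) ⊆ ℤⁿ` associated to a subset `U ⊆ {1,…,n}`:
`uᵢ ≥ 0` for `i ∈ U` and `uᵢ ≤ -1` for `i ∉ U`. -/
def Block (n : ℕ) (U : Set (Fin n)) : Set (Fin n → ℤ) :=
  { u | ∀ i : Fin n, (i ∈ U → 0 ≤ u i) ∧ (i ∉ U → u i ≤ -1) }


open MvPolynomial in
/-- A homogeneous polynomial is zero or a single term. -/
theorem IsHomog.eq_zero_or_monomial {n : ℕ} {A : Type} [CommRing A] {r : PolyR n A}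
    {d : Fin n → ℤ} (h : IsHomog r d) :
    r = 0 ∨ ∃ (s : Fin n →₀ ℕ) (c : A), (∀ j, (s j : ℤ) = d j) ∧ r = monomial s c := by
  by_cases hr : r = 0
  · exact Or.inl hr
  obtain ⟨s, hs⟩ := Finset.nonempty_iff_ne_empty.2 (mt support_eq_empty.1 hr)
  refine Or.inr ⟨s, coeff s r, fun j => congrFun (h s hs) j, ?_⟩
  ext t
  rw [coeff_monomial]
  split_ifs with hst
  · rw [hst]
  · by_contra hne
    refine hst (Finsupp.ext fun j => ?_)
    have h₁ := congrFun (h s hs) j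
    have h₂ := congrFun (h t (mem_support_iff.2 hne)) j
    omega

theorem isHomog_monomial {n : ℕ} {A : Type} [CommRing A] (s : Fin n →₀ ℕ) (c : A) :
    IsHomog (MvPolynomial.monomial s c : PolyR n A) (fun j => (s j : ℤ)) := by
  intro t ht
  rw [Finset.mem_singleton.1 (MvPolynomial.support_monomial_subset ht)]

section Frobenius

variable {M : Type} [AddCommGroup M] [Module (PolyR n A) M]

variable (p) in
/-- The pure tensor `r ⊗ m` in `F(M)`. -/
def FF.tmul (r : PolyR n A) (m : M) : FF p n A M :=
  FF.of p n A M (twist p n A r ⊗ₜ[PolyR n A] m)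

theorem FF.smul_tmul (s r : PolyR n A) (m : M) :
    s • FF.tmul p r m = FF.tmul p (s * r) m := rfl

theorem FF.tmul_smul (s r : PolyR n A) (m : M) :
    FF.tmul p r (s • m) = FF.tmul p (s ^ p * r) m :=
  (TensorProduct.smul_tmul s (twist p n A r) m).symm

theorem FF.add_tmul (r s : PolyR n A) (m : M) :
    FF.tmul p (r + s) m = FF.tmul p r m + FF.tmul p s m :=
  TensorProduct.add_tmul (twist p n A r) (twist p n A s) m

theorem FF.tmul_add (r : PolyR n A) (m m' : M) :
    FF.tmul p r (m + m') = FF.tmul p r m + FF.tmul p r m' :=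
  TensorProduct.tmul_add (twist p n A r) m m'

theorem FF.zero_tmul (m : M) : FF.tmul p (0 : PolyR n A) m = 0 :=
  TensorProduct.zero_tmul _ m

theorem FF.tmul_zero (r : PolyR n A) : FF.tmul p r (0 : M) = 0 :=
  TensorProduct.tmul_zero _ (twist p n A r)

theorem FF.scalar_smul_tmul (a : A) (r : PolyR n A) (m : M) :
    a • FF.tmul p r m = FF.tmul p (MvPolynomial.C a * r) m := rfl

theorem FF.tmul_mem_comp [Module A M] {gr : (Fin n → ℤ) → Submodule A M}
    {s : Fin n →₀ ℕ} {c : A} {v u : Fin n → ℤ} {m : M} (hm : m ∈ gr v)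
    (h : ∀ j, (s j : ℤ) + p * v j = u j) :
    FF.tmul p (MvPolynomial.monomial s c) m ∈ FF.comp p n A M gr u := by
  refine Submodule.subset_span ⟨_, _, v, m, isHomog_monomial s c, hm, ?_, rfl⟩
  funext j
  simpa using h j

/-- To prove an additive property on a graded piece of `F(M)` it suffices to prove it for the
tensors of a term with a homogeneous element. -/
theorem FF.comp_induction [Module A M] {gr : (Fin n → ℤ) → Submodule A M} {u : Fin n → ℤ}
    {S : AddSubmonoid (FF p n A M)}
    (h : ∀ (s : Fin n →₀ ℕ) (c : A) (v : Fin n → ℤ) (m : M), m ∈ gr v →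
      (∀ j, (s j : ℤ) + p * v j = u j) → FF.tmul p (MvPolynomial.monomial s c) m ∈ S)
    {z : FF p n A M} (hz : z ∈ FF.comp p n A M gr u) : z ∈ S := by
  have key : ∀ a : A, a • z ∈ S := by
    induction hz using Submodule.span_induction with
    | mem x hx =>
      intro a
      obtain ⟨r, d, v, m, hr, hm, hd, rfl⟩ := hx
      change a • FF.tmul p r m ∈ S
      rw [FF.scalar_smul_tmul]
      obtain rfl | ⟨s, c, hs, rfl⟩ := hr.eq_zero_or_monomial
      · rw [mul_zero, FF.zero_tmul]
        exact S.zero_mem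
      · rw [MvPolynomial.C_mul_monomial]
        refine h s _ v m hm fun j => ?_
        rw [hs, ← hd]
        simp
    | zero => intro a; rw [smul_zero]; exact S.zero_mem
    | add x y _ _ hx hy => intro a; rw [smul_add]; exact S.add_mem (hx a) (hy a)
    | smul b x _ hx => intro a; rw [smul_smul]; exact hx _
  simpa using key 1

end Frobenius

section Grading

variable {K M : Type} [Field K] [AddCommGroup M] [Module K M] [Module (PolyR n K) M]
  {gr : (Fin n → ℤ) → Submodule K M}

/-- If `Xᵢ y` is homogeneous, then it is `Xᵢ` times a homogeneous element. -/
theorem exists_mem_X_smul_eq (hint : DirectSum.IsInternal gr)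
    (hX : ∀ (i : Fin n) (u : Fin n → ℤ), ∀ m ∈ gr u,
      (MvPolynomial.X i : PolyR n K) • m ∈ gr (u + Pi.single i 1))
    {i : Fin n} {u : Fin n → ℤ} {y : M} (hy : (MvPolynomial.X i : PolyR n K) • y ∈ gr u) :
    ∃ m' ∈ gr (u - Pi.single i 1),
      (MvPolynomial.X i : PolyR n K) • m' = (MvPolynomial.X i : PolyR n K) • y := by
  classical
  let _ := hint.chooseDecomposition
  have key : ∀ y : M, (DirectSum.decompose gr ((MvPolynomial.X i : PolyR n K) • y) u : M) =
      (MvPolynomial.X i : PolyR n K) •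
        (DirectSum.decompose gr y (u - Pi.single i 1) : M) := by
    intro y
    induction y using DirectSum.Decomposition.inductionOn gr with
    | zero => simp
    | add a b ha hb => simp [smul_add, DirectSum.decompose_add, ha, hb]
    | @homogeneous v m =>
      have hm := hX i v m m.2
      by_cases hv : v = u - Pi.single i 1
      · subst hv
        rw [sub_add_cancel] at hm
        rw [DirectSum.decompose_of_mem_same gr hm, DirectSum.decompose_of_mem_same gr m.2]
      · rw [DirectSum.decompose_of_mem_ne gr hm, DirectSum.decompose_of_mem_ne gr m.2 hv,
          smul_zero]
        exact fun h => hv (eq_sub_of_add_eq h)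
  exact ⟨_, (DirectSum.decompose gr y (u - Pi.single i 1)).2, by
    rw [← key, DirectSum.decompose_of_mem_same gr hy]⟩

theorem monomial_one_smul_mem
    (hX : ∀ (i : Fin n) (u : Fin n → ℤ), ∀ m ∈ gr u,
      (MvPolynomial.X i : PolyR n K) • m ∈ gr (u + Pi.single i 1))
    (k : Fin n →₀ ℕ) {v : Fin n → ℤ} {m : M} (hm : m ∈ gr v) :
    (MvPolynomial.monomial k 1 : PolyR n K) • m ∈ gr (v + fun j => (k j : ℤ)) := by
  classical
  induction k using Finsupp.induction_linear generalizing v m with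
  | zero => simpa [← Pi.zero_def] using hm
  | add k l hk hl =>
    have h := hk (hl hm)
    rw [smul_smul, MvPolynomial.monomial_mul, one_mul, add_assoc] at h
    convert h using 2
    funext j
    simp [add_comm]
  | single i a =>
    induction a with
    | zero => simpa [← Pi.zero_def] using hm
    | succ a ih =>
      have h := hX i _ _ ih
      rw [smul_smul, MvPolynomial.X, MvPolynomial.monomial_mul, one_mul, add_assoc,
        ← Finsupp.single_add, add_comm 1 a] at h
      convert h using 2
      funext j
      by_cases hj : i = j
      · subst hj; simp
      · simp [Finsupp.single_apply, hj, Ne.symm hj]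

end Grading

section Basis

variable {K : Type} [Field K] [CharP K p]

/-- `K` as a vector space over itself via the Frobenius. -/
@[nolint unusedArguments]
def FrobField (_p : ℕ) (K : Type) : Type := K

instance (p : ℕ) (K : Type) [Field K] : AddCommGroup (FrobField p K) :=
  inferInstanceAs (AddCommGroup K)

instance (p : ℕ) (K : Type) [Field K] [Fact p.Prime] [CharP K p] : Module K (FrobField p K) :=
  Module.compHom K (frobenius K p)

variable (p K) in
/-- A basis of `K` over its subfield of `p`-th powers, together with its coordinate functions
followed by the `p`-th root. -/
theorem exists_frobenius_basis : ∃ (ι : Type) (b : ι → K) (φ : ι → K →+ K),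
    (∀ α a c, φ α (a ^ p * c) = a * φ α c) ∧ (∀ α, φ α (b α) = 1) ∧
    (∀ α β, α ≠ β → φ α (b β) = 0) ∧
    ∀ S : AddSubmonoid K, (∀ α k, k ^ p * b α ∈ S) → ∀ c, c ∈ S := by
  let b := Module.Basis.ofVectorSpace K (FrobField p K)
  refine ⟨_, fun α => b α, fun α => (b.coord α).toAddMonoidHom,
    fun α a c => (b.coord α).map_smul a c, fun α => ?_, fun α β h => ?_, fun S hS c => ?_⟩
  · change b.repr (b α) α = 1
    simp
  · change b.repr (b β) α = 0
    simp [h.symm]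
  · have hc : b.repr.symm (b.repr c) = c := b.repr.symm_apply_apply c
    rw [Module.Basis.repr_symm_apply, Finsupp.linearCombination_apply, Finsupp.sum] at hc
    rw [← hc]
    exact S.sum_mem fun α _ => hS α _

/-- The coefficient extraction `∑ c_d X^d ↦ ∑ φ(c_{e + p k}) X^k`, for `e` with entries less
than `p`. -/
def extractHom (φ : K →+ K) (e : Fin n →₀ ℕ) : FrobTwist p n K →+ PolyR n K := by
  classical
  exact (Finsupp.liftAddHom (fun d : Fin n →₀ ℕ =>
    if ∀ j, e j + p * (d j / p) = d j then
      (MvPolynomial.monomial (d.mapRange (· / p) (Nat.zero_div p)) :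
        K →ₗ[K] PolyR n K).toAddMonoidHom.comp φ
    else (0 : K →+ PolyR n K))).comp
      (AddMonoidAlgebra.coeffAddEquiv : PolyR n K ≃+ ((Fin n →₀ ℕ) →₀ K)).toAddMonoidHom

theorem extractHom_monomial {q : ℕ} {K : Type} [Field K] (φ : K →+ K) (e d : Fin n →₀ ℕ) (c : K) :
    extractHom φ e (twist q n K (MvPolynomial.monomial d c)) =
      open Classical in if ∀ j, e j + q * (d j / q) = d j then
        MvPolynomial.monomial (d.mapRange (· / q) (Nat.zero_div q)) (φ c) else 0 := by
  classical
  refine (Finsupp.liftAddHom_apply_single _ d c).trans ?_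
  split_ifs <;> rfl

theorem twist_monomial_smul (d a : Fin n →₀ ℕ) (c k : K) :
    (MvPolynomial.monomial a k : PolyR n K) • twist p n K (MvPolynomial.monomial d c) =
      twist p n K (MvPolynomial.monomial (p • a + d) (k ^ p * c)) := by
  change twist p n K ((MvPolynomial.monomial a k) ^ p * MvPolynomial.monomial d c) = _
  rw [MvPolynomial.monomial_pow, MvPolynomial.monomial_mul]

/-- `extractHom` as a linear map over the Frobenius. -/
def extract (φ : K →+ K) (hφ : ∀ a c, φ (a ^ p * c) = a * φ c) (e : Fin n →₀ ℕ) :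
    FrobTwist p n K →ₗ[PolyR n K] PolyR n K where
  toFun := extractHom φ e
  map_add' := map_add _
  map_smul' r s := by
    simp only [RingHom.id_apply]
    induction r using MvPolynomial.induction_on' with
    | add r r' h h' => rw [add_smul, map_add, h, h', add_smul]
    | monomial a k =>
      change PolyR n K at s
      change extractHom φ e (_ • twist p n K s) = _ • extractHom φ e (twist p n K s)
      induction s using MvPolynomial.induction_on' with
      | add s s' h h' =>
        change extractHom φ e (_ • (twist p n K s + twist p n K s')) =
          _ • extractHom φ e (twist p n K s + twist p n K s')
        rw [smul_add, map_add, h, h', map_add, smul_add]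
      | monomial d c =>
        have hp := (Fact.out : p.Prime).pos
        have hdiv : ∀ j, (p • a + d) j / p = a j + d j / p := fun j => by
          simp [Nat.mul_add_div hp]
        rw [twist_monomial_smul, extractHom_monomial, extractHom_monomial, smul_eq_mul, mul_ite,
          mul_zero, hφ, MvPolynomial.monomial_mul]
        refine if_congr (forall_congr' fun j => ?_) ?_ rfl
        · rw [hdiv, mul_add]
          simp only [Finsupp.coe_add, Finsupp.coe_smul, Pi.add_apply, Pi.smul_apply, smul_eq_mul]
          omega
        · congr 1
          exact congrArg _ (Finsupp.ext fun j => by simpa using hdiv j)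

theorem extract_monomial (φ : K →+ K) (hφ : ∀ a c, φ (a ^ p * c) = a * φ c) {e : Fin n →₀ ℕ}
    (he : ∀ j, e j < p) (c : K) :
    extract φ hφ e (twist p n K (MvPolynomial.monomial e c)) = MvPolynomial.C (φ c) := by
  classical
  refine (extractHom_monomial φ e e c).trans ?_
  rw [if_pos fun j => by rw [Nat.div_eq_of_lt (he j)]; rfl, MvPolynomial.C_apply]
  exact congrArg (MvPolynomial.monomial · (φ c))
    (Finsupp.ext fun j => by simp [Nat.div_eq_of_lt (he j)])

variable {M : Type} [AddCommGroup M] [Module (PolyR n K) M] {ι : Type}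

/-- The map `⨁_α M → F(M)` sending `m` in the summand `α` to `b_α X^e ⊗ m`. -/
def FF.sumHom (p : ℕ) [Fact p.Prime] [CharP K p] (b : ι → K) (e : Fin n →₀ ℕ) :
    (ι →₀ M) →+ FF p n K M :=
  Finsupp.liftAddHom fun α =>
    AddMonoidHom.mk' (FF.tmul p (MvPolynomial.monomial e (b α))) (FF.tmul_add _)

theorem FF.sumHom_single (b : ι → K) (e : Fin n →₀ ℕ) (α : ι) (m : M) :
    FF.sumHom p b e (Finsupp.single α m) = FF.tmul p (MvPolynomial.monomial e (b α)) m :=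
  Finsupp.liftAddHom_apply_single _ α m

theorem FF.X_smul_sumHom (b : ι → K) (e : Fin n →₀ ℕ) (i : Fin n) (f : ι →₀ M) :
    (MvPolynomial.X i : PolyR n K) • FF.sumHom p b e f =
      FF.sumHom p b (Finsupp.single i 1 + e) f := by
  induction f using Finsupp.induction_linear with
  | zero => simp
  | add f g hf hg => rw [map_add, smul_add, hf, hg, map_add]
  | single α m =>
    rw [FF.sumHom_single, FF.sumHom_single, FF.smul_tmul, MvPolynomial.X,
      MvPolynomial.monomial_mul, one_mul]

theorem FF.sumHom_mapRange_X_smul (b : ι → K) (e : Fin n →₀ ℕ) (i : Fin n) (f : ι →₀ M) :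
    FF.sumHom p b e (f.mapRange (fun m => (MvPolynomial.X i : PolyR n K) • m) (smul_zero _)) =
      FF.sumHom p b (Finsupp.single i p + e) f := by
  induction f using Finsupp.induction_linear with
  | zero => simp
  | add f g hf hg => rw [Finsupp.mapRange_add (fun _ _ => smul_add _ _ _), map_add, hf, hg, map_add]
  | single α m =>
    rw [Finsupp.mapRange_single, FF.sumHom_single, FF.sumHom_single, FF.tmul_smul,
      MvPolynomial.X_pow_eq_monomial, MvPolynomial.monomial_mul, one_mul]

variable [Module K M] {gr : (Fin n → ℤ) → Submodule K M} {i : Fin n} {u : Fin n → ℤ}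

/-- If `Xᵢ : M_{v - eᵢ} → M_v` is surjective for all `v` with `p vᵢ = uᵢ`, then
`F(M)_u ⊆ Xᵢ F(M)`. -/
theorem FF.exists_X_smul_eq
    (h : ∀ v : Fin n → ℤ, p * v i = u i → ∀ m ∈ gr v,
      ∃ m' ∈ gr (v - Pi.single i 1), (MvPolynomial.X i : PolyR n K) • m' = m)
    {z : FF p n K M} (hz : z ∈ FF.comp p n K M gr u) :
    ∃ y, (MvPolynomial.X i : PolyR n K) • y = z := by
  refine FF.comp_induction (S := AddMonoidHom.mrange (DistribSMul.toAddMonoidHom (FF p n K M)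
    (MvPolynomial.X i : PolyR n K))) (fun s c v m hm hs => ?_) hz
  obtain ⟨t, ht⟩ | hsi : (∃ t, s = Finsupp.single i 1 + t) ∨ s i = 0 := by
    by_cases hsi : s i = 0
    · exact Or.inr hsi
    · refine Or.inl (exists_add_of_le ?_)
      rw [Finsupp.single_le_iff]
      omega
  · refine ⟨FF.tmul p (MvPolynomial.monomial t c) m, ?_⟩
    refine (FF.smul_tmul (MvPolynomial.X i) _ m).trans ?_
    rw [MvPolynomial.X, MvPolynomial.monomial_mul, one_mul, ← ht]
  · obtain ⟨m', -, rfl⟩ := h v (by simpa [hsi] using hs i) m hm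
    refine ⟨FF.tmul p (MvPolynomial.X i ^ (p - 1) * MvPolynomial.monomial s c) m', ?_⟩
    refine (FF.smul_tmul (MvPolynomial.X i) _ m').trans ?_
    rw [FF.tmul_smul, ← mul_assoc, ← pow_succ',
      Nat.sub_add_cancel (Fact.out : p.Prime).one_le]

variable [IsScalarTower K (PolyR n K) M]

/-- The map `F(M) → M` induced by coefficient extraction. -/
def extractFF (φ : K →+ K) (hφ : ∀ a c, φ (a ^ p * c) = a * φ c) (e : Fin n →₀ ℕ) :
    FF p n K M →+ M :=
  ((TensorProduct.lid (PolyR n K) M).toLinearMap ∘ₗ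
    LinearMap.rTensor M (extract φ hφ e)).toAddMonoidHom

theorem extractFF_tmul (φ : K →+ K) (hφ : ∀ a c, φ (a ^ p * c) = a * φ c) {e : Fin n →₀ ℕ}
    (he : ∀ j, e j < p) (c : K) (m : M) :
    extractFF φ hφ e (FF.tmul p (MvPolynomial.monomial e c) m) = φ c • m := by
  change extract φ hφ e (twist p n K (MvPolynomial.monomial e c)) • m = _
  rw [extract_monomial φ hφ he]
  exact algebraMap_smul (PolyR n K) (φ c) m

theorem FF.tmul_monomial_smul (e : Fin n →₀ ℕ) (k c : K) (m : M) :
    FF.tmul p (MvPolynomial.monomial e c) (k • m) =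
      FF.tmul p (MvPolynomial.monomial e (k ^ p * c)) m := by
  rw [← algebraMap_smul (PolyR n K) k m, FF.tmul_smul, MvPolynomial.algebraMap_eq, ← map_pow,
    MvPolynomial.C_mul_monomial]

theorem extractFF_sumHom {b : ι → K} {φ : ι → K →+ K}
    (hφ : ∀ α a c, φ α (a ^ p * c) = a * φ α c) (h₁ : ∀ α, φ α (b α) = 1)
    (h₀ : ∀ α β, α ≠ β → φ α (b β) = 0) {e : Fin n →₀ ℕ} (he : ∀ j, e j < p) (f : ι →₀ M)
    (α : ι) : extractFF (φ α) (hφ α) e (FF.sumHom p b e f) = f α := by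
  classical
  induction f using Finsupp.induction_linear with
  | zero => simp
  | add f g hf hg => rw [map_add, map_add, hf, hg, Finsupp.add_apply]
  | single β m =>
    rw [FF.sumHom_single, extractFF_tmul _ _ he, Finsupp.single_apply]
    split_ifs with h
    · rw [h, h₁, one_smul]
    · rw [h₀ α β (Ne.symm h), zero_smul]

/-- Every element of a graded piece of `F(M)` is a sum of tensors `b_α X^e ⊗ m_α`. -/
theorem FF.exists_sumHom_eq
    (hX : ∀ (i : Fin n) (u : Fin n → ℤ), ∀ m ∈ gr u,
      (MvPolynomial.X i : PolyR n K) • m ∈ gr (u + Pi.single i 1))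
    {b : ι → K} (hb : ∀ S : AddSubmonoid K, (∀ α k, k ^ p * b α ∈ S) → ∀ c, c ∈ S)
    {e : Fin n →₀ ℕ} (he : ∀ j, e j < p) {v w : Fin n → ℤ} (hw : ∀ j, (e j : ℤ) + p * v j = w j)
    {z : FF p n K M} (hz : z ∈ FF.comp p n K M gr w) :
    ∃ f : ι →₀ M, (∀ α, f α ∈ gr v) ∧ FF.sumHom p b e f = z := by
  classical
  let S : AddSubmonoid (FF p n K M) :=
    { carrier := {z | ∃ f : ι →₀ M, (∀ α, f α ∈ gr v) ∧ FF.sumHom p b e f = z}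
      zero_mem' := ⟨0, fun α => (gr v).zero_mem, map_zero _⟩
      add_mem' := by
        rintro _ _ ⟨f, hf, rfl⟩ ⟨g, hg, rfl⟩
        exact ⟨f + g, fun α => (gr v).add_mem (hf α) (hg α), map_add _ _ _⟩ }
  have key : ∀ (c : K) (m : M), m ∈ gr v → FF.tmul p (MvPolynomial.monomial e c) m ∈ S := by
    let T : AddSubmonoid K :=
      { carrier := {c | ∀ m : M, m ∈ gr v → FF.tmul p (MvPolynomial.monomial e c) m ∈ S}
        zero_mem' := fun m _ => by
          rw [map_zero, FF.zero_tmul]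
          exact S.zero_mem
        add_mem' := fun {c d} hc hd m hm => by
          rw [map_add, FF.add_tmul]
          exact S.add_mem (hc m hm) (hd m hm) }
    refine hb T fun α k m hm => ?_
    rw [← FF.tmul_monomial_smul]
    refine ⟨Finsupp.single α (k • m), fun β => ?_, FF.sumHom_single b e α _⟩
    rw [Finsupp.single_apply]
    split_ifs
    · exact (gr v).smul_mem k hm
    · exact (gr v).zero_mem
  refine FF.comp_induction (S := S) (fun s c v' m hm hs => ?_) hz
  have hp : (0 : ℤ) < p := by exact_mod_cast (Fact.out : p.Prime).pos
  let k : Fin n →₀ ℕ := s.mapRange (· / p) (Nat.zero_div p)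
  have hk : ∀ j, (s j : ℤ) = e j + p * k j ∧ v j = v' j + k j := by
    intro j
    have hdm := Nat.div_add_mod (s j) p
    have hlt := Nat.mod_lt (s j) (Fact.out : p.Prime).pos
    have hkj : k j = s j / p := Finsupp.mapRange_apply ..
    rw [← hkj] at hdm
    have h := (hs j).trans (hw j).symm
    have hz : (s j : ℤ) = p * k j + (s j % p : ℕ) := by exact_mod_cast hdm.symm
    have hv : v j = v' j + k j := by
      have hej := he j
      have h₁ : (p : ℤ) * (v j - v' j - k j) = (s j % p : ℕ) - e j := by linarith
      have h₂ : (p : ℤ) * (v j - v' j - k j) < p * 1 := by omega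
      have h₃ : (p : ℤ) * (-1) < p * (v j - v' j - k j) := by omega
      have h₄ := lt_of_mul_lt_mul_left h₂ hp.le
      have h₅ := lt_of_mul_lt_mul_left h₃ hp.le
      omega
    refine ⟨?_, hv⟩
    rw [hv] at h
    linarith
  have hs' : s = p • k + e := by
    ext j
    have := (hk j).1
    simp only [Finsupp.coe_add, Finsupp.coe_smul, Pi.add_apply, Pi.smul_apply, smul_eq_mul]
    zify
    linarith
  have hv : v = v' + fun j => (k j : ℤ) := funext fun j => (hk j).2
  have hmk := key c _ (hv ▸ monomial_one_smul_mem hX k hm)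
  rwa [FF.tmul_smul, MvPolynomial.monomial_pow, one_pow, MvPolynomial.monomial_mul, one_mul,
    ← hs'] at hmk

/-- If `Xᵢ : M_{v - eᵢ} → M_v` is injective for all `v` with `p vᵢ = uᵢ`, then
`Xᵢ` is injective on `F(M)_{u - eᵢ}`. -/
theorem FF.eq_zero_of_X_smul_eq_zero
    (hX : ∀ (i : Fin n) (u : Fin n → ℤ), ∀ m ∈ gr u,
      (MvPolynomial.X i : PolyR n K) • m ∈ gr (u + Pi.single i 1))
    (h : ∀ v : Fin n → ℤ, p * v i = u i → ∀ m ∈ gr (v - Pi.single i 1),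
      (MvPolynomial.X i : PolyR n K) • m = 0 → m = 0)
    {z : FF p n K M} (hz : z ∈ FF.comp p n K M gr (u - Pi.single i 1))
    (h₀ : (MvPolynomial.X i : PolyR n K) • z = 0) : z = 0 := by
  obtain ⟨ι, b, φ, hφ, hφ₁, hφ₀, hb⟩ := exists_frobenius_basis p K
  have hp : (0 : ℤ) < p := by exact_mod_cast (Fact.out : p.Prime).pos
  set w := u - Pi.single i 1 with hw
  let e : Fin n →₀ ℕ := Finsupp.equivFunOnFinite.symm fun j => (w j % p).toNat
  have hew : ∀ j, (e j : ℤ) = w j % p := fun j => Int.toNat_of_nonneg (Int.emod_nonneg _ hp.ne')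
  have he : ∀ j, e j < p := fun j => by
    have := Int.emod_lt_of_pos (w j) hp
    rw [← hew] at this
    exact_mod_cast this
  have hev : ∀ j, (e j : ℤ) + p * (w j / p) = w j := fun j => by
    rw [hew, Int.emod_add_mul_ediv]
  have hinj : ∀ (e' : Fin n →₀ ℕ), (∀ j, e' j < p) → ∀ g : ι →₀ M,
      FF.sumHom p b e' g = 0 → g = 0 := fun e' he' g hg => Finsupp.ext fun α => by
    rw [← extractFF_sumHom hφ hφ₁ hφ₀ he' g α, hg, map_zero, Finsupp.zero_apply]
  obtain ⟨f, hf, rfl⟩ := FF.exists_sumHom_eq hX hb he hev hz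
  suffices hf₀ : f = 0 by rw [hf₀, map_zero]
  rw [FF.X_smul_sumHom] at h₀
  by_cases hei : e i + 1 < p
  · refine hinj _ (fun j => ?_) f h₀
    by_cases hj : i = j
    · subst hj
      simpa [add_comm] using hei
    · simpa [Finsupp.single_apply, hj] using he j
  · have hei' : e i + 1 = p := le_antisymm (he i) (not_lt.1 hei)
    have hsplit : Finsupp.single i 1 + e = Finsupp.single i p + e.erase i := by
      ext j
      by_cases hj : i = j
      · subst hj
        simpa [add_comm] using hei'
      · simp [hj, Finsupp.erase_ne (Ne.symm hj)]
    rw [hsplit, ← FF.sumHom_mapRange_X_smul] at h₀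
    have hXf := hinj _ (fun j => ?_) _ h₀
    · ext α
      refine h ((fun j => w j / p) + Pi.single i 1) ?_ (f α) ?_ ?_
      · have h₁ := hev i
        have h₂ : w i = u i - 1 := by simp [hw]
        have h₃ : (e i : ℤ) + 1 = p := by exact_mod_cast hei'
        simp only [Pi.add_apply, Pi.single_eq_same]
        linarith
      · rw [add_sub_cancel_right]
        exact hf α
      · simpa using DFunLike.congr_fun hXf α
    · by_cases hj : j = i
      · rw [hj, Finsupp.erase_same]
        exact (Fact.out : p.Prime).pos
      · rw [Finsupp.erase_ne hj]
        exact he j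

end Basis

theorem natAbs_lt_of_prime_mul_eq {p : ℕ} (hp : p.Prime) {a b : ℤ} (hb : b ≠ 0)
    (h : p * a = b) : a ≠ 0 ∧ a.natAbs < b.natAbs := by
  have ha : a ≠ 0 := by rintro rfl; exact hb (by rw [← h, mul_zero])
  refine ⟨ha, ?_⟩
  rw [← h, Int.natAbs_mul, Int.natAbs_natCast]
  have := Int.natAbs_pos.2 ha
  nlinarith [hp.two_le]

/-- Let `M` be a `ℤⁿ`-graded `F`-finite `F`-module over `R = K[X₁,…,Xₙ]`.
Then for every `i`, `j ∈ {0,1}` and every `u ∈ ℤⁿ` with `uᵢ ≠ 0` the degree-`u` component of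
the Koszul homology `H_j(Xᵢ; M)` vanishes; explicitly `M_u = Xᵢ·M_{u-eᵢ}` (vanishing of
`H₀(Xᵢ; M)_u = (M/XᵢM)_u`) and multiplication `Xᵢ : M_{u-eᵢ} → M_u` is injective (vanishing of
`H₁(Xᵢ; M)_u = (0 :_M Xᵢ)_u ⊆ M_{u-eᵢ}`), hence `Xᵢ : M_{u-eᵢ} → M_u` is bijective. -/
theorem koszul_components_vanish_of_ne_zero
    (p n : ℕ) [Fact p.Prime] (K : Type) [Field K] [CharP K p]
    (M : Type) [AddCommGroup M] [Module K M] [Module (PolyR n K) M]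
    [IsScalarTower K (PolyR n K) M]
    (gr : (Fin n → ℤ) → Submodule K M)
    (hM : ZGradedFFiniteFModule p n K M gr)
    (i : Fin n) (u : Fin n → ℤ) (hu : u i ≠ 0) :
    (∀ m ∈ gr u, ∃ m' ∈ gr (u - Pi.single i 1), (MvPolynomial.X i : PolyR n K) • m' = m) ∧
    (∀ m ∈ gr (u - Pi.single i 1), (MvPolynomial.X i : PolyR n K) • m = 0 → m = 0) := by
  induction hk : (u i).natAbs using Nat.strong_induction_on generalizing u with
  | _ k ih =>
    subst hk
    have ih' : ∀ v : Fin n → ℤ, p * v i = u i →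
        (∀ m ∈ gr v, ∃ m' ∈ gr (v - Pi.single i 1), (MvPolynomial.X i : PolyR n K) • m' = m) ∧
        (∀ m ∈ gr (v - Pi.single i 1), (MvPolynomial.X i : PolyR n K) • m = 0 → m = 0) :=
      fun v hv =>
        have h := natAbs_lt_of_prime_mul_eq (Fact.out : p.Prime) hu hv
        ih _ h.2 v h.1 rfl
    refine ⟨fun m hm => ?_, fun m hm h₀ => ?_⟩
    · obtain ⟨y, hy⟩ := FF.exists_X_smul_eq (fun v hv => (ih' v hv).1) (hM.theta_grade u m hm)
      have hy' : (MvPolynomial.X i : PolyR n K) • hM.theta.symm y = m := by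
        rw [← map_smul, hy, LinearEquiv.symm_apply_apply]
      obtain ⟨m', hm', h⟩ := exists_mem_X_smul_eq hM.isInternal hM.smul_X_mem
        (hy'.symm ▸ hm : (MvPolynomial.X i : PolyR n K) • hM.theta.symm y ∈ gr u)
      exact ⟨m', hm', h.trans hy'⟩
    · refine hM.theta.map_eq_zero_iff.1 (FF.eq_zero_of_X_smul_eq_zero hM.smul_X_mem
        (fun v hv => (ih' v hv).2) (hM.theta_grade _ m hm) ?_)
      rw [← map_smul, h₀, map_zero]
end
end

section
/- Let K be an infinite field of characteristic p > 0 and let M be a ℤⁿ-graded F-finite F-module over R = K[X₁,…,Xₙ]. If there exists t ∈ ℕ such that M_u = 0 for every u ∈ ℤⁿ satisfying |uᵢ| ≥ t for all i ∈ {1,…,n}, then M = 0. -/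
set_option maxHeartbeats 1000000
set_option synthInstance.maxHeartbeats 1000000

open scoped TensorProduct

noncomputable section

variable {p n : ℕ} {A : Type} [CommRing A] [Fact p.Prime] [CharP A p]

section FrobeniusFunctional

variable {K : Type} [Field K] {M : Type} [AddCommGroup M] [Module K M]

/-- In a graded module each nonzero homogeneous element is detected by a functional that vanishes
on all other components. -/
theorem exists_functional_of_isInternal {gr : (Fin n → ℤ) → Submodule K M}
    (h : DirectSum.IsInternal gr) {v : Fin n → ℤ} {m : M} (hm : m ∈ gr v) (hm0 : m ≠ 0) :
    ∃ φ : M →ₗ[K] K, φ m ≠ 0 ∧ ∀ w ≠ v, ∀ x ∈ gr w, φ x = 0 := by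
  let e := LinearEquiv.ofBijective (DirectSum.coeLinearMap gr) h
  have he : ∀ (w : Fin n → ℤ) (x : gr w),
      e.symm (x : M) = DirectSum.lof K _ (fun i => gr i) w x := by
    intro w x
    rw [LinearEquiv.symm_apply_eq]
    exact (DirectSum.coeLinearMap_lof gr w x).symm
  obtain ⟨ψ, hψ⟩ : ∃ ψ : Module.Dual K (gr v), ψ ⟨m, hm⟩ ≠ 0 := by
    by_contra! hall
    exact hm0 (congrArg Subtype.val ((Module.forall_dual_apply_eq_zero_iff K _).1 hall))
  refine ⟨ψ ∘ₗ DirectSum.component K _ (fun i => gr i) v ∘ₗ e.symm.toLinearMap, ?_, ?_⟩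
  · simpa [he v ⟨m, hm⟩, DirectSum.component.lof_self] using hψ
  · intro w hw x hx
    simp [he w ⟨x, hx⟩, DirectSum.component.of, hw]

variable [Module (PolyR n K) M]

theorem monomial_smul_mem {gr : (Fin n → ℤ) → Submodule K M}
    (hX : ∀ (i : Fin n) (u : Fin n → ℤ), ∀ m ∈ gr u,
      (MvPolynomial.X i : PolyR n K) • m ∈ gr (u + Pi.single i 1))
    (b : Fin n →₀ ℕ) {w : Fin n → ℤ} {m : M} (hm : m ∈ gr w) :
    (MvPolynomial.monomial b 1 : PolyR n K) • m ∈ gr (w + fun i => (b i : ℤ)) := by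
  induction b using Finsupp.induction_linear generalizing w m with
  | zero =>
    rw [MvPolynomial.monomial_zero', MvPolynomial.C_1, one_smul]
    convert hm using 2
    ext i
    simp
  | add b c hb hc =>
    rw [← one_mul (1 : K), ← MvPolynomial.monomial_mul, mul_smul]
    convert hb (hc hm) using 2
    ext i
    simp only [Pi.add_apply, Finsupp.add_apply]
    push_cast
    ring
  | single i k =>
    rw [← MvPolynomial.X_pow_eq_monomial]
    induction k with
    | zero =>
      rw [pow_zero, one_smul]
      convert hm using 2
      ext j
      simp
    | succ k ih =>
      rw [pow_succ', mul_smul]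
      convert hX i _ _ ih using 2
      ext j
      by_cases hj : j = i
      · subst hj
        simp [add_assoc]
      · simp [hj]

variable [CharP K p]

/-- The `p`-th power of the functional `φ` evaluated at `X ^ b • m`, where `d = a + p • b`,
and zero if the exponent `d` is not congruent to `a` modulo `p`. -/
def frobCoeff (p : ℕ) [Fact p.Prime] [CharP K p] (φ : M →ₗ[K] K) (a d : Fin n →₀ ℕ) : M →+ K :=
  if ∀ i, d i % p = a i then
    (frobenius K p : K →+ K).comp (φ.toAddMonoidHom.comp (DistribSMul.toAddMonoidHom M
      (MvPolynomial.monomial (d.mapRange (· / p) (Nat.zero_div p)) 1 : PolyR n K)))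
  else 0

theorem frobCoeff_of_mod_eq (φ : M →ₗ[K] K) {a d : Fin n →₀ ℕ} (h : ∀ i, d i % p = a i) (m : M) :
    frobCoeff p φ a d m =
      φ ((MvPolynomial.monomial (d.mapRange (· / p) (Nat.zero_div p)) 1 : PolyR n K) • m) ^ p := by
  rw [frobCoeff, if_pos h]
  rfl

theorem frobCoeff_of_not_mod_eq (φ : M →ₗ[K] K) {a d : Fin n →₀ ℕ} (h : ¬ ∀ i, d i % p = a i)
    (m : M) : frobCoeff p φ a d m = 0 := by
  rw [frobCoeff, if_neg h]
  rfl

theorem frobCoeff_add_single (φ : M →ₗ[K] K) (a d : Fin n →₀ ℕ) (i : Fin n) (m : M) :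
    frobCoeff p φ a (d + Finsupp.single i p) m =
      frobCoeff p φ a d ((MvPolynomial.X i : PolyR n K) • m) := by
  have hp : 0 < p := (Fact.out : p.Prime).pos
  have hmod : ∀ j, (d + Finsupp.single i p) j % p = d j % p := by
    intro j
    by_cases hj : i = j <;> simp [hj]
  by_cases h : ∀ j, d j % p = a j
  · rw [frobCoeff_of_mod_eq φ (fun j => (hmod j).trans (h j)), frobCoeff_of_mod_eq φ h,
      ← mul_smul, MvPolynomial.X, MvPolynomial.monomial_mul, one_mul]
    congr 5
    ext j
    by_cases hj : i = j <;> simp [hj, Nat.add_div_right _ hp]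
  · rw [frobCoeff_of_not_mod_eq φ h, frobCoeff_of_not_mod_eq φ (by simpa only [hmod] using h)]

/-- The pairing `(∑ c_d X ^ d, m) ↦ ∑ c_{a + p b} φ(X ^ b m) ^ p`. -/
def frobPairing (p : ℕ) [Fact p.Prime] [CharP K p] (φ : M →ₗ[K] K) (a : Fin n →₀ ℕ) :
    PolyR n K →ₗ[K] (M →+ K) :=
  (MvPolynomial.basisMonomials (Fin n) K).constr K (frobCoeff p φ a)

theorem frobPairing_monomial (φ : M →ₗ[K] K) (a d : Fin n →₀ ℕ) (c : K) (m : M) :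
    frobPairing p φ a (MvPolynomial.monomial d c) m = c * frobCoeff p φ a d m := by
  have h : (MvPolynomial.monomial d c : PolyR n K) =
      c • MvPolynomial.basisMonomials (Fin n) K d := by
    simp [MvPolynomial.smul_monomial]
  rw [h, map_smul, frobPairing, Module.Basis.constr_basis]
  rfl

theorem frobPairing_X_pow_mul (φ : M →ₗ[K] K) (a : Fin n →₀ ℕ) (i : Fin n) (r : PolyR n K)
    (m : M) : frobPairing p φ a (MvPolynomial.X i ^ p * r) m =
      frobPairing p φ a r ((MvPolynomial.X i : PolyR n K) • m) := by
  induction r using MvPolynomial.induction_on' with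
  | monomial d c =>
    rw [mul_comm, MvPolynomial.X_pow_eq_monomial, MvPolynomial.monomial_mul, mul_one,
      frobPairing_monomial, frobPairing_monomial, frobCoeff_add_single]
  | add r s hr hs => simp only [mul_add, map_add, AddMonoidHom.add_apply, hr, hs]

theorem frobCoeff_smul [IsScalarTower K (PolyR n K) M] (φ : M →ₗ[K] K) (a d : Fin n →₀ ℕ) (c : K)
    (m : M) : frobCoeff p φ a d (c • m) = c ^ p * frobCoeff p φ a d m := by
  by_cases h : ∀ i, d i % p = a i
  · rw [frobCoeff_of_mod_eq φ h, frobCoeff_of_mod_eq φ h, smul_algebra_smul_comm, map_smul,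
      smul_eq_mul, mul_pow]
  · rw [frobCoeff_of_not_mod_eq φ h, frobCoeff_of_not_mod_eq φ h, mul_zero]

theorem frobPairing_smul [IsScalarTower K (PolyR n K) M] (φ : M →ₗ[K] K) (a : Fin n →₀ ℕ) (c : K)
    (r : PolyR n K) (m : M) :
    frobPairing p φ a r (c • m) = c ^ p * frobPairing p φ a r m := by
  induction r using MvPolynomial.induction_on' with
  | monomial d b => rw [frobPairing_monomial, frobPairing_monomial, frobCoeff_smul]; ring
  | add r s hr hs => simp only [map_add, AddMonoidHom.add_apply, hr, hs, mul_add]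

theorem frobPairing_pow_mul [IsScalarTower K (PolyR n K) M] (φ : M →ₗ[K] K) (a : Fin n →₀ ℕ)
    (s r : PolyR n K) (m : M) :
    frobPairing p φ a (s ^ p * r) m = frobPairing p φ a r (s • m) := by
  induction s using MvPolynomial.induction_on generalizing r m with
  | C c =>
    rw [← map_pow, ← MvPolynomial.smul_eq_C_mul, map_smul, ← MvPolynomial.algebraMap_eq,
      algebraMap_smul, frobPairing_smul]
    rfl
  | add s t hs ht =>
    simp only [add_pow_char, add_mul, add_smul, map_add, AddMonoidHom.add_apply, hs, ht]
  | mul_X s i hs => rw [mul_pow, mul_assoc, hs, frobPairing_X_pow_mul, mul_comm s, mul_smul]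

/-- The additive functional on `F(M)` induced by `frobPairing`. -/
def frobFunctional [IsScalarTower K (PolyR n K) M] (p : ℕ) [Fact p.Prime] [CharP K p]
    (φ : M →ₗ[K] K) (a : Fin n →₀ ℕ) : FF p n K M →+ K :=
  TensorProduct.liftAddHom (R := PolyR n K) (M := FrobTwist p n K) (N := M)
    (frobPairing p φ a).toAddMonoidHom fun s r m => frobPairing_pow_mul φ a s r m

variable [IsScalarTower K (PolyR n K) M]

theorem frobFunctional_tmul (φ : M →ₗ[K] K) (a : Fin n →₀ ℕ) (r : PolyR n K) (m : M) :
    frobFunctional p φ a (FF.of p n K M (twist p n K r ⊗ₜ[PolyR n K] m)) =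
      frobPairing p φ a r m := rfl

theorem frobFunctional_smul (φ : M →ₗ[K] K) (a : Fin n →₀ ℕ) (c : K) (x : FF p n K M) :
    frobFunctional p φ a (c • x) = c * frobFunctional p φ a x := by
  change FrobTwist p n K ⊗[PolyR n K] M at x
  change frobFunctional p φ a (c • FF.of p n K M x) = c * frobFunctional p φ a (FF.of p n K M x)
  induction x using TensorProduct.induction_on with
  | zero =>
    change frobFunctional p φ a (c • (0 : FF p n K M)) = c * frobFunctional p φ a (0 : FF p n K M)
    rw [smul_zero, map_zero, mul_zero]
  | tmul r m =>
    have h : c • FF.of p n K M (r ⊗ₜ[PolyR n K] m) =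
        FF.of p n K M (twist p n K (MvPolynomial.C c * (show PolyR n K from r)) ⊗ₜ[PolyR n K] m) :=
      rfl
    rw [h, frobFunctional_tmul, ← MvPolynomial.smul_eq_C_mul, map_smul]
    rfl
  | add x y hx hy =>
    change frobFunctional p φ a (c • (FF.of p n K M x + FF.of p n K M y)) =
      c * frobFunctional p φ a (FF.of p n K M x + FF.of p n K M y)
    rw [smul_add, map_add, map_add, hx, hy, mul_add]

theorem frobFunctional_eq_zero {gr : (Fin n → ℤ) → Submodule K M}
    (hX : ∀ (i : Fin n) (u : Fin n → ℤ), ∀ m ∈ gr u,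
      (MvPolynomial.X i : PolyR n K) • m ∈ gr (u + Pi.single i 1))
    {φ : M →ₗ[K] K} {v : Fin n → ℤ} (hφ : ∀ w ≠ v, ∀ m ∈ gr w, φ m = 0) {a : Fin n →₀ ℕ}
    {u : Fin n → ℤ} (hu : u ≠ p • v + fun i => (a i : ℤ)) {x : FF p n K M}
    (hx : x ∈ FF.comp p n K M gr u) : frobFunctional p φ a x = 0 := by
  induction hx using Submodule.span_induction with
  | zero => exact map_zero _
  | add x y _ _ hx hy => rw [map_add, hx, hy, add_zero]
  | smul c x _ hx => rw [frobFunctional_smul, hx, mul_zero]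
  | mem x hx =>
    obtain ⟨r, d, w, m, hr, hm, hd, rfl⟩ := hx
    rw [frobFunctional_tmul, r.as_sum, map_sum, AddMonoidHom.finsetSum_apply]
    refine Finset.sum_eq_zero fun e he => ?_
    rw [frobPairing_monomial]
    by_cases h : ∀ i, e i % p = a i
    · rw [frobCoeff_of_mod_eq φ h, hφ _ ?_ _ (monomial_smul_mem hX _ hm),
        zero_pow (Fact.out : p.Prime).ne_zero, mul_zero]
      rintro rfl
      refine hu ?_
      rw [← hd, ← hr e he]
      ext i
      have h1 := Nat.div_add_mod (e i) p
      rw [h i] at h1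
      simp only [Pi.add_apply, Pi.smul_apply, Finsupp.mapRange_apply]
      zify at h1
      rw [← h1]
      simp only [nsmul_eq_mul]
      push_cast
      ring
    · rw [frobCoeff_of_not_mod_eq φ h, mul_zero]

theorem frobFunctional_monomial_tmul (φ : M →ₗ[K] K) {a : Fin n →₀ ℕ} (ha : ∀ i, a i < p) (m : M) :
    frobFunctional p φ a (FF.of p n K M
      (twist p n K (MvPolynomial.monomial a 1) ⊗ₜ[PolyR n K] m)) = φ m ^ p := by
  have h0 : a.mapRange (· / p) (Nat.zero_div p) = 0 := by
    ext i
    simpa using Nat.div_eq_of_lt (ha i)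
  rw [frobFunctional_tmul, frobPairing_monomial,
    frobCoeff_of_mod_eq φ fun i => Nat.mod_eq_of_lt (ha i), h0, one_mul,
    MvPolynomial.monomial_zero', MvPolynomial.C_1, one_smul]

/-- If `M ≅ F(M)` as graded modules, then `M_v` vanishes as soon as `M_{p v + a}` does for some
`0 ≤ a < p`. -/
theorem gr_eq_bot_of_gr_smul_add_eq_bot {gr : (Fin n → ℤ) → Submodule K M}
    (hM : ZGradedFFiniteFModule p n K M gr) {v : Fin n → ℤ} {a : Fin n →₀ ℕ}
    (ha : ∀ i, a i < p) (hbot : gr (p • v + fun i => (a i : ℤ)) = ⊥) : gr v = ⊥ := by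
  refine (Submodule.eq_bot_iff _).2 fun m hm => by_contra fun hm0 => ?_
  obtain ⟨φ, hφm, hφ⟩ := exists_functional_of_isInternal hM.isInternal hm hm0
  have hzero : ∀ x : M, frobFunctional p φ a (hM.theta x) = 0 := by
    intro x
    have hx : x ∈ iSup gr := hM.isInternal.submodule_iSup_eq_top ▸ Submodule.mem_top
    induction hx using Submodule.iSup_induction' with
    | zero => rw [map_zero, map_zero]
    | add x y _ _ hx hy => rw [map_add, map_add, hx, hy, add_zero]
    | mem u x hx =>
      by_cases hu : u = p • v + fun i => (a i : ℤ)
      · rw [hu, hbot, Submodule.mem_bot] at hx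
        rw [hx, map_zero, map_zero]
      · exact frobFunctional_eq_zero hM.smul_X_mem hφ hu (hM.theta_grade u x hx)
  have h := frobFunctional_monomial_tmul φ ha m
  rw [← hM.theta.apply_symm_apply (FF.of p n K M _), hzero] at h
  exact hφm (eq_zero_of_pow_eq_zero h.symm)

end FrobeniusFunctional

/-- **Theorem 4.2.** Let `K` be an infinite field of characteristic `p > 0` and
`M` a `ℤⁿ`-graded `F`-finite `F`-module over `R = K[X₁,…,Xₙ]`.  If there is a `t ∈ ℕ` such that
`M_u = 0` for every `u` with `|uᵢ| ≥ t` for all `i`, then `M = 0`. -/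
theorem vanishing_of_almost_all_components
    (p n : ℕ) [Fact p.Prime] (K : Type) [Field K] [CharP K p] [Infinite K]
    (M : Type) [AddCommGroup M] [Module K M] [Module (PolyR n K) M]
    [IsScalarTower K (PolyR n K) M]
    (gr : (Fin n → ℤ) → Submodule K M)
    (hM : ZGradedFFiniteFModule p n K M gr)
    (t : ℕ) (hvan : ∀ u : Fin n → ℤ, (∀ i, (t : ℤ) ≤ |u i|) → gr u = ⊥) :
    ∀ m : M, m = 0 := by
  have hp : 2 ≤ p := (Fact.out : p.Prime).two_le
  have key : ∀ (k : ℕ) (v : Fin n → ℤ), (∀ i, (t : ℤ) ≤ |v i| + k) → gr v = ⊥ := by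
    intro k
    induction k with
    | zero => exact fun v hv => hvan v (by simpa using hv)
    | succ k ih =>
      intro v hv
      refine gr_eq_bot_of_gr_smul_add_eq_bot hM
        (a := Finsupp.equivFunOnFinite.symm fun i => if 0 ≤ v i then p - 1 else 0) ?_ (ih _ ?_)
      · intro i
        simp only [Finsupp.equivFunOnFinite_symm_apply_apply]
        split_ifs <;> omega
      · intro i
        have hi := hv i
        have hp' : (2 : ℤ) ≤ p := by exact_mod_cast hp
        push_cast at hi
        simp only [Pi.add_apply, Pi.smul_apply, Finsupp.equivFunOnFinite_symm_apply_apply]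
        rw [nsmul_eq_mul]
        split_ifs with h
        · rw [Nat.cast_sub (by omega), Nat.cast_one]
          rw [abs_of_nonneg h] at hi
          rw [abs_of_nonneg (by nlinarith)]
          nlinarith
        · push Not at h
          rw [abs_of_neg h] at hi
          rw [Nat.cast_zero, add_zero, abs_of_neg (by nlinarith)]
          nlinarith
  have hgr : ∀ v, gr v = ⊥ := fun v => key t v fun i => by
    linarith [abs_nonneg (v i)]
  intro m
  have hm : m ∈ iSup gr := hM.isInternal.submodule_iSup_eq_top ▸ Submodule.mem_top
  rwa [iSup_eq_bot.2 hgr, Submodule.mem_bot] at hm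
end
end
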